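/- Weighted L⁴ estimate: There exists C > 0 such that for every sufficiently smooth θ on [-1,1] with θ'(-1) = θ'(1) = 0, ‖θ'/h_s‖_{L⁴} + ‖θ''‖_{L⁴} ≤ C ( ‖h_s^{3/2} θ''''‖_{L²} + ‖h_s^{1/2} θ'''‖_{L²} + ‖θ''‖_{L²} ), where all norms are over (-1,1). -/

import Mathlib

noncomputable def hs : ℝ → ℝ := fun x =>
  (Real.exp 1 ^ 2 + 1) / (Real.exp 1 ^ 2 - 1) -
    (Real.exp (x + 1) + Real.exp (1 - x)) / (Real.exp 1 ^ 2 - 1)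

open Set in
lemma aux_sup (f g : ℝ → ℝ) (hf : ContinuousOn f (Icc (-1) 1)) (hg : ContinuousOn g (Icc (-1) 1))
    (hd : ∀ x ∈ Ioo (-1:ℝ) 1, HasDerivAt f (g x) x) (y : ℝ) (hy : y ∈ Icc (-1:ℝ) 1) :
    (1 - y^2) * f y ^ 2 ≤ ∫ x in (-1:ℝ)..1, (3 * f x ^ 2 + (1 - x^2) * g x ^ 2) := by
  have hsub : Icc (-1) y ⊆ Icc (-1:ℝ) 1 := Icc_subset_Icc le_rfl hy.2
  have h1 : ∫ x in (-1:ℝ)..y, (-(2 * x) * f x ^ 2 + (1 - x^2) * (2 * f x * g x))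
      = (1 - y^2) * f y ^ 2 - (1 - (-1)^2) * f (-1) ^ 2 := by
    apply intervalIntegral.integral_eq_sub_of_hasDerivAt_of_le (f := fun x => (1 - x^2) * f x ^ 2) hy.1
    · exact ContinuousOn.mono (by fun_prop) hsub
    · intro x hx
      have hx' := hd x ⟨hx.1, hx.2.trans_le hy.2⟩
      have := (((hasDerivAt_id x).pow 2).const_sub 1).mul (hx'.pow 2)
      refine this.congr_deriv ?_
      simp
    · apply ContinuousOn.intervalIntegrable
      rw [uIcc_of_le hy.1]
      exact ContinuousOn.mono (by fun_prop) hsub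
  have hint : IntervalIntegrable (fun x => 3 * f x ^ 2 + (1 - x^2) * g x ^ 2) MeasureTheory.volume (-1) 1 := by
    apply ContinuousOn.intervalIntegrable
    rw [uIcc_of_le (by norm_num)]
    fun_prop
  have h2 : ∫ x in (-1:ℝ)..y, (-(2 * x) * f x ^ 2 + (1 - x^2) * (2 * f x * g x)) ≤
      ∫ x in (-1:ℝ)..y, (3 * f x ^ 2 + (1 - x^2) * g x ^ 2) := by
    apply intervalIntegral.integral_mono_on hy.1
    · apply ContinuousOn.intervalIntegrable
      rw [uIcc_of_le hy.1]
      exact ContinuousOn.mono (by fun_prop) hsub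
    · apply ContinuousOn.intervalIntegrable
      rw [uIcc_of_le hy.1]
      exact ContinuousOn.mono (by fun_prop) hsub
    · intro x hx
      have hx1 := hx.1
      have hx2 := hx.2.trans hy.2
      have hd0 : 0 ≤ 1 - x^2 := by nlinarith
      have e1 := mul_nonneg hd0 (sq_nonneg (f x - g x))
      have e2 := mul_nonneg (sq_nonneg x) (sq_nonneg (f x))
      have e3 := mul_nonneg (by linarith : 0 ≤ 1 + x) (sq_nonneg (f x))
      nlinarith
  have h3 : ∫ x in (-1:ℝ)..y, (3 * f x ^ 2 + (1 - x^2) * g x ^ 2) ≤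
      ∫ x in (-1:ℝ)..1, (3 * f x ^ 2 + (1 - x^2) * g x ^ 2) := by
    apply intervalIntegral.integral_mono_interval le_rfl hy.1 hy.2 _ hint
    refine (MeasureTheory.ae_restrict_iff' measurableSet_Ioc).2 (Filter.Eventually.of_forall ?_)
    intro x hx
    have hd0 : 0 ≤ 1 - x^2 := by nlinarith [hx.1, hx.2]
    show 0 ≤ 3 * f x ^ 2 + (1 - x^2) * g x ^ 2
    positivity
  have hz : (1 - (-1:ℝ)^2) * f (-1) ^ 2 = 0 := by norm_num
  rw [hz, sub_zero] at h1
  linarith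

open Set in
lemma aux_L4 (f g : ℝ → ℝ) (hf : ContinuousOn f (Icc (-1) 1)) (hg : ContinuousOn g (Icc (-1) 1))
    (hd : ∀ x ∈ Ioo (-1:ℝ) 1, HasDerivAt f (g x) x) :
    ∫ x in (-1:ℝ)..1, f x ^ 4 ≤
      12 * ((∫ x in (-1:ℝ)..1, f x ^ 2) + ∫ x in (-1:ℝ)..1, (1 - x^2) * g x ^ 2) ^ 2 := by
  have II : ∀ F : ℝ → ℝ, ContinuousOn F (Icc (-1) 1) →
      IntervalIntegrable F MeasureTheory.volume (-1) 1 := by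
    intro F hF
    apply ContinuousOn.intervalIntegrable
    rwa [uIcc_of_le (by norm_num)]
  have hS := aux_sup f g hf hg hd
  rw [intervalIntegral.integral_add (II _ (by fun_prop)) (II _ (by fun_prop)),
    intervalIntegral.integral_const_mul] at hS
  set P := ∫ x in (-1:ℝ)..1, f x ^ 2 with hP
  set Q := ∫ x in (-1:ℝ)..1, (1 - x^2) * g x ^ 2 with hQ
  have hP0 : 0 ≤ P := intervalIntegral.integral_nonneg (by norm_num) (fun x _ => sq_nonneg _)
  have hQ0 : 0 ≤ Q := intervalIntegral.integral_nonneg (by norm_num) (fun x hx => by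
    have : 0 ≤ 1 - x^2 := by nlinarith [hx.1, hx.2]
    positivity)
  have h1 : ∫ x in (-1:ℝ)..1, ((1 - 3 * x^2) * f x ^ 4 + (x * (1 - x^2)) * (4 * f x ^ 3 * g x))
      = (1 * (1 - 1^2)) * f 1 ^ 4 - ((-1) * (1 - (-1)^2)) * f (-1) ^ 4 := by
    apply intervalIntegral.integral_eq_sub_of_hasDerivAt_of_le
      (f := fun x => (x * (1 - x^2)) * f x ^ 4) (by norm_num)
    · fun_prop
    · intro x hx
      have hx' := hd x hx
      have := ((hasDerivAt_id x).mul (((hasDerivAt_id x).pow 2).const_sub 1)).mul (hx'.pow 4)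
      refine this.congr_deriv ?_
      simp only [Pi.mul_apply, Pi.pow_apply, id]; push_cast; ring
    · exact II _ (by fun_prop)
  have h2 : ∫ x in (-1:ℝ)..1, f x ^ 4 ≤ ∫ x in (-1:ℝ)..1,
      (((1 - 3 * x^2) * f x ^ 4 + (x * (1 - x^2)) * (4 * f x ^ 3 * g x)) * (-1)
        + (3 * (3 * P + Q) * f x ^ 2 + 4 * (3 * P + Q) * ((1 - x^2) * g x ^ 2))) := by
    apply intervalIntegral.integral_mono_on (by norm_num) (II _ (by fun_prop)) (II _ (by fun_prop))
    intro x hx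
    have hd0 : 0 ≤ 1 - x^2 := by nlinarith [hx.1, hx.2]
    have hx2 : 0 ≤ x^2 := sq_nonneg x
    have s := hS x hx
    have e1 := mul_le_mul_of_nonneg_right s (sq_nonneg (f x))
    have e2 := mul_le_mul_of_nonneg_right s (mul_nonneg hd0 (sq_nonneg (g x)))
    have e3 := sq_nonneg (f x ^ 2 - 2 * x * (1 - x^2) * f x * g x)
    have e4 := mul_nonneg hd0 (mul_nonneg (sq_nonneg (f x * g x)) (mul_nonneg hd0 hd0))
    nlinarith
  simp only [mul_neg, mul_one] at h2
  rw [intervalIntegral.integral_add (II _ (by fun_prop)) (II _ (by fun_prop)),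
    intervalIntegral.integral_neg, h1,
    intervalIntegral.integral_add (II _ (by fun_prop)) (II _ (by fun_prop)),
    intervalIntegral.integral_const_mul, intervalIntegral.integral_const_mul, ← hP, ← hQ] at h2
  norm_num at h2
  nlinarith [mul_nonneg hP0 hQ0]

lemma young4 (a b : ℝ) : -(4 * a^3 * b) ≤ 1/2 * a^4 + 216 * b^4 := by
  -- b = c/6: 3a^4 + c^4 + 4 a^3 c >= 0
  have : 0 ≤ (a + 6*b)^2 * (2 * a^2 + (a - 6*b)^2) := by positivity
  nlinarith

open Set in
lemma aux_hardy (u f : ℝ → ℝ) (hu : ContinuousOn u (Icc (-1) 1)) (hf : ContinuousOn f (Icc (-1) 1))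
    (hd : ∀ x ∈ Ioo (-1:ℝ) 1, HasDerivAt u (f x) x) (h0 : u (-1) = 0) (h1 : u 1 = 0) :
    IntervalIntegrable (fun x => (u x / (1 - x^2)) ^ 4) MeasureTheory.volume (-1) 1 ∧
    ∫ x in (-1:ℝ)..1, (u x / (1 - x^2)) ^ 4 ≤ 432 * ∫ x in (-1:ℝ)..1, f x ^ 4 := by
  obtain ⟨K, hK⟩ := isCompact_Icc.exists_bound_of_continuousOn hf
  have hK0 : 0 ≤ K := (norm_nonneg _).trans (hK 0 (by norm_num))
  have dpos : ∀ x ∈ Ioo (-1:ℝ) 1, 0 < 1 - x^2 := fun x hx => by nlinarith [hx.1, hx.2]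
  -- Lipschitz
  have hI : ∀ a ∈ Icc (-1:ℝ) 1, ∀ b ∈ Icc (-1:ℝ) 1, a ≤ b → |u b - u a| ≤ K * (b - a) := by
    intro a ha b hb hab
    have hs : Icc a b ⊆ Icc (-1) 1 := Icc_subset_Icc ha.1 hb.2
    have := intervalIntegral.integral_eq_sub_of_hasDerivAt_of_le hab (hu.mono hs)
      (fun x hx => hd x ⟨ha.1.trans_lt hx.1, hx.2.trans_le hb.2⟩)
      (ContinuousOn.intervalIntegrable (by rw [uIcc_of_le hab]; exact hf.mono hs))
    rw [← this]
    have h2 := intervalIntegral.norm_integral_le_of_norm_le_const (a := a) (b := b) (f := f) (C := K)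
      (fun x hx => hK x (hs (by rw [uIoc_of_le hab] at hx; exact Ioc_subset_Icc_self hx)))
    rwa [abs_of_nonneg (sub_nonneg.2 hab)] at h2
  have hub : ∀ x ∈ Icc (-1:ℝ) 1, |u x| ≤ K * (1 - x^2) := by
    intro x hx
    rcases le_total x 0 with h | h
    · have := hI (-1) (by norm_num) x hx hx.1
      rw [h0, sub_zero] at this
      exact this.trans (mul_le_mul_of_nonneg_left (by nlinarith [hx.1]) hK0)
    · have := hI x hx 1 (by norm_num) hx.2
      rw [h1, zero_sub, abs_neg] at this
      exact this.trans (mul_le_mul_of_nonneg_left (by nlinarith [hx.2]) hK0)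
  set v : ℝ → ℝ := fun x => u x / (1 - x^2) with hv
  have hvb : ∀ x ∈ Icc (-1:ℝ) 1, |v x| ≤ K := by
    intro x hx
    have hd0 : 0 ≤ 1 - x^2 := by nlinarith [hx.1, hx.2]
    rw [hv]; simp only
    rw [abs_div, abs_of_nonneg hd0]
    exact div_le_of_le_mul₀ hd0 hK0 (hub x hx)
  have hvc : ContinuousOn v (Ioo (-1) 1) :=
    (hu.mono Ioo_subset_Icc_self).div (by fun_prop) (fun x hx => (dpos x hx).ne')
  have hfc : ContinuousOn f (Ioo (-1) 1) := hf.mono Ioo_subset_Icc_self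
  have II : ∀ F : ℝ → ℝ, ContinuousOn F (Ioo (-1) 1) → (∃ B, ∀ x ∈ Ioo (-1:ℝ) 1, |F x| ≤ B) →
      IntervalIntegrable F MeasureTheory.volume (-1) 1 := by
    rintro F hF ⟨B, hB⟩
    rw [intervalIntegrable_iff_integrableOn_Ioo_of_le (by norm_num)]
    refine MeasureTheory.IntegrableOn.of_bound (C := B) ?_ ?_ ?_
    · simp
    · exact hF.aestronglyMeasurable measurableSet_Ioo
    · exact (MeasureTheory.ae_restrict_iff' measurableSet_Ioo).2 (Filter.Eventually.of_forall hB)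
  have i4 : IntervalIntegrable (fun x => v x ^ 4) MeasureTheory.volume (-1) 1 := by
    refine II _ (by fun_prop) ⟨K^4, fun x hx => ?_⟩
    rw [abs_pow]
    exact pow_le_pow_left₀ (abs_nonneg _) (hvb x (Ioo_subset_Icc_self hx)) 4
  have if4 : IntervalIntegrable (fun x => f x ^ 4) MeasureTheory.volume (-1) 1 := by
    apply ContinuousOn.intervalIntegrable
    rw [uIcc_of_le (by norm_num)]
    fun_prop
  refine ⟨i4, ?_⟩
  have iG : IntervalIntegrable (fun x => 6 * v x ^ 4 - 5 * ((1 - x^2) * v x ^ 4) + 4 * x * v x ^ 3 * f x)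
      MeasureTheory.volume (-1) 1 := by
    refine II _ (by fun_prop) ⟨6 * K^4 + 5 * (1 * K^4) + 4 * 1 * K^3 * K, fun x hx => ?_⟩
    have hb := hvb x (Ioo_subset_Icc_self hx)
    have hb' : |f x| ≤ K := hK x (Ioo_subset_Icc_self hx)
    have hx1 : |x| ≤ 1 := abs_le.2 ⟨hx.1.le, hx.2.le⟩
    have hx2 : |1 - x^2| ≤ 1 := by rw [abs_of_pos (dpos x hx)]; nlinarith
    refine (abs_add_le _ _).trans (add_le_add ((abs_sub _ _).trans (add_le_add ?_ ?_)) ?_)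
    · rw [abs_mul, abs_pow]; norm_num; gcongr
    · rw [abs_mul, abs_mul, abs_pow]; norm_num
      calc _ ≤ 1 * K^4 := by gcongr
        _ = _ := by ring
    · rw [abs_mul, abs_mul, abs_mul, abs_pow]; norm_num
      calc 4 * |x| * |v x|^3 * |f x| ≤ 4 * 1 * K^3 * K := by gcongr
        _ = _ := by ring
  have hF : ∫ x in (-1:ℝ)..1, (6 * v x ^ 4 - 5 * ((1 - x^2) * v x ^ 4) + 4 * x * v x ^ 3 * f x)
      = 1 * (1 - 1^2) * v 1 ^ 4 - (-1) * (1 - (-1)^2) * v (-1) ^ 4 := by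
    apply intervalIntegral.integral_eq_sub_of_hasDerivAt_of_le
      (f := fun x => x * (1 - x^2) * v x ^ 4) (by norm_num) _ _ iG
    · intro x hx
      by_cases hx' : x ∈ Ioo (-1:ℝ) 1
      · have : ContinuousAt v x := hvc.continuousAt (isOpen_Ioo.mem_nhds hx')
        exact ContinuousAt.continuousWithinAt (by fun_prop)
      · have hz : 1 - x^2 = 0 := by
          have : x = -1 ∨ x = 1 := by
            by_contra hc; push Not at hc
            exact hx' ⟨lt_of_le_of_ne hx.1 (Ne.symm hc.1), lt_of_le_of_ne hx.2 hc.2⟩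
          rcases this with h | h <;> rw [h] <;> norm_num
        have hzero : x * (1 - x^2) * v x ^ 4 = 0 := by rw [hz]; ring
        rw [ContinuousWithinAt, hzero]
        have hlim : Filter.Tendsto (fun y : ℝ => (1 - y^2) * K^4) (nhdsWithin x (Icc (-1) 1)) (nhds 0) := by
          have : ContinuousWithinAt (fun y : ℝ => (1 - y^2) * K^4) (Icc (-1) 1) x := by fun_prop
          rw [ContinuousWithinAt, hz, zero_mul] at this
          exact this
        refine squeeze_zero_norm' ?_ hlim
        filter_upwards [self_mem_nhdsWithin] with y hy
        have hd0 : 0 ≤ 1 - y^2 := by nlinarith [hy.1, hy.2]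
        have hy1 : |y| ≤ 1 := abs_le.2 hy
        have := hvb y hy
        rw [Real.norm_eq_abs, abs_mul, abs_mul, abs_pow, abs_of_nonneg hd0]
        calc |y| * (1 - y^2) * |v y|^4 ≤ 1 * (1 - y^2) * K^4 := by gcongr
          _ = _ := by ring
    · intro x hx
      have hne := (dpos x hx).ne'
      have hdd : HasDerivAt (fun y : ℝ => 1 - y^2) (-(2 * x)) x := by
        simpa using ((hasDerivAt_id x).pow 2).const_sub 1
      have hvd : HasDerivAt v _ x := (hd x hx).div hdd hne
      have := ((hasDerivAt_id x).mul hdd).mul (hvd.pow 4)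
      refine this.congr_deriv ?_
      have hux : u x = v x * (1 - x^2) := by rw [hv]; field_simp
      rw [hux]
      simp
      field_simp
      ring
  have hmono : ∫ x in (-1:ℝ)..1, v x ^ 4 ≤ ∫ x in (-1:ℝ)..1,
      ((6 * v x ^ 4 - 5 * ((1 - x^2) * v x ^ 4) + 4 * x * v x ^ 3 * f x) + 
        (1/2 * v x ^ 4 + 216 * f x ^ 4)) := by
    apply intervalIntegral.integral_mono_on (by norm_num) i4
      (iG.add ((i4.const_mul _).add (if4.const_mul _)))
    intro x hx
    have hx2 : x^2 ≤ 1 := by nlinarith [hx.1, hx.2]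
    have y := young4 (v x) (x * f x)
    have e1 : 0 ≤ x^2 * v x ^ 4 := by positivity
    have e2 : (x * f x)^4 ≤ f x ^ 4 := by
      rw [mul_pow]
      have : x^4 ≤ 1 := by nlinarith [sq_nonneg x]
      have h4 : 0 ≤ f x ^ 4 := by positivity
      nlinarith
    nlinarith
  rw [intervalIntegral.integral_add iG ((i4.const_mul _).add (if4.const_mul _)), hF,
    intervalIntegral.integral_add (i4.const_mul _) (if4.const_mul _),
    intervalIntegral.integral_const_mul, intervalIntegral.integral_const_mul] at hmono
  norm_num at hmono
  linarith

lemma hs_eq (x : ℝ) : (Real.exp 1 ^ 2 - 1) * hs x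
    = (Real.exp 1 - Real.exp x) * (Real.exp 1 - Real.exp (-x)) := by
  have h : Real.exp 1 ^ 2 - 1 ≠ 0 := by
    have := Real.add_one_lt_exp (one_ne_zero)
    nlinarith
  unfold hs
  rw [Real.exp_add, sub_eq_add_neg 1 x, Real.exp_add]
  field_simp
  have : Real.exp x * Real.exp (-x) = 1 := by rw [← Real.exp_add]; simp
  linear_combination -this

lemma exp_bd (x : ℝ) (h1 : -1 ≤ x) (hx : x ≤ 1) : Real.exp (-1) * (1 - x) ≤ Real.exp 1 - Real.exp x ∧
    (Real.exp 1 - Real.exp x) ≤ Real.exp 1 * (1 - x) := by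
  constructor
  · have a := Real.add_one_le_exp (1 - x)
    have b : Real.exp 1 = Real.exp x * Real.exp (1 - x) := by rw [← Real.exp_add]; ring_nf
    have c : Real.exp (-1) ≤ Real.exp x := Real.exp_le_exp.2 h1
    have d := Real.exp_pos (-1)
    nlinarith
  · have a := Real.add_one_le_exp (x - 1)
    have b : Real.exp x = Real.exp 1 * Real.exp (x - 1) := by rw [← Real.exp_add]; ring_nf
    rw [b]
    nlinarith [Real.exp_pos 1]

lemma hs_bd : ∃ c1 > (0:ℝ), ∃ c2 > (0:ℝ), ∀ x ∈ Set.Icc (-1:ℝ) 1,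
    c1 * (1 - x^2) ≤ hs x ∧ hs x ≤ c2 * (1 - x^2) := by
  have hM : 0 < Real.exp 1 ^ 2 - 1 := by
    have := Real.add_one_lt_exp (one_ne_zero)
    nlinarith
  refine ⟨Real.exp (-1) ^ 2 / (Real.exp 1 ^ 2 - 1), by positivity,
    Real.exp 1 ^ 2 / (Real.exp 1 ^ 2 - 1), by positivity, fun x hx => ?_⟩
  have e := hs_eq x
  have h : hs x = (Real.exp 1 - Real.exp x) * (Real.exp 1 - Real.exp (-x)) / (Real.exp 1 ^ 2 - 1) := by
    rw [← e]; field_simp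
  obtain ⟨a1, a2⟩ := exp_bd x hx.1 hx.2
  obtain ⟨b1, b2⟩ := exp_bd (-x) (by linarith [hx.2]) (by linarith [hx.1])
  have hx1 : 0 ≤ 1 - x := by linarith [hx.2]
  have hx2 : 0 ≤ 1 - -x := by linarith [hx.1]
  have p1 := Real.exp_pos (-1)
  have p2 := Real.exp_pos 1
  rw [h, div_mul_eq_mul_div, div_mul_eq_mul_div]
  constructor
  · apply div_le_div_of_nonneg_right _ hM.le
    calc _ = (Real.exp (-1) * (1 - x)) * (Real.exp (-1) * (1 - -x)) := by ring
      _ ≤ _ := mul_le_mul a1 b1 (by positivity) ((by positivity : (0:ℝ) ≤ _).trans a1)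
  · apply div_le_div_of_nonneg_right _ hM.le
    calc _ ≤ (Real.exp 1 * (1 - x)) * (Real.exp 1 * (1 - -x)) := 
          mul_le_mul a2 b2 ((by positivity : (0:ℝ) ≤ _).trans b1) (by positivity)
      _ = _ := by ring

open Set Filter Topology in
lemma endpoint (u : ℝ → ℝ) (hu : ContinuousOn u (Icc (-1) 1)) (c : ℝ) (hc : c = 1 ∨ c = -1)
    (hint : IntervalIntegrable (fun x => (u x / hs x) ^ 4) MeasureTheory.volume (-1) 1) :
    u c = 0 := by
  by_contra hne
  obtain ⟨c1, hc1, c2, hc2, hb⟩ := hs_bd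
  have ha : 0 < |u c| := abs_pos.2 hne
  set a := |u c| with hadef
  have hcI : c ∈ Icc (-1:ℝ) 1 := by rcases hc with rfl | rfl <;> norm_num
  have hev : ∀ᶠ x in 𝓝[Icc (-1:ℝ) 1] c, a / 2 < |u x| :=
    ((hu c hcI).abs).eventually (lt_mem_nhds (by linarith))
  rw [eventually_nhdsWithin_iff] at hev
  classical
  let G : ℝ → ℝ := fun x => if x ∈ Ioo (-1:ℝ) 1 then (u x / hs x) ^ 4 else (x - c)⁻¹
  have hG : IntervalIntegrable G MeasureTheory.volume (-1) 1 := by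
    rw [intervalIntegrable_iff_integrableOn_Ioo_of_le (by norm_num)] at hint ⊢
    refine hint.congr_fun (fun x hx => ?_) measurableSet_Ioo
    simp only [G, if_pos hx]
  refine not_intervalIntegrable_of_sub_inv_isBigO_punctured (c := c) ?_ (by norm_num)
    (by rw [uIcc_of_le (by norm_num)]; exact hcI) hG
  refine Asymptotics.IsBigO.of_bound (1 + 2 * (2 * c2 / a) ^ 4) ?_
  have hpos : 0 ≤ 2 * (2 * c2 / a) ^ 4 := by positivity
  filter_upwards [hev.filter_mono nhdsWithin_le_nhds, self_mem_nhdsWithin] with x hx hxc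
  by_cases hxI : x ∈ Ioo (-1:ℝ) 1
  · simp only [G, if_pos hxI]
    have hxI' := Ioo_subset_Icc_self hxI
    have hux := hx hxI'
    have hd : 0 < 1 - x^2 := by nlinarith [hxI.1, hxI.2]
    have hd1 : 1 - x^2 ≤ 1 := by nlinarith
    obtain ⟨b1, b2⟩ := hb x hxI'
    have hsp : 0 < hs x := lt_of_lt_of_le (by positivity) b1
    have hdc : 1 - x^2 ≤ 2 * |x - c| := by
      rcases hc with rfl | rfl
      · rw [abs_of_neg (by linarith [hxI.2])]; nlinarith [hxI.1, hxI.2]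
      · rw [abs_of_pos (by linarith [hxI.1])]; nlinarith [hxI.1, hxI.2]
    have hxc0 : 0 < |x - c| := by linarith
    have key : a / 2 / (c2 * (1 - x^2)) ≤ |u x / hs x| := by
      rw [abs_div, abs_of_pos hsp]
      exact div_le_div₀ (abs_nonneg _) hux.le hsp b2
    have key4 := pow_le_pow_left₀ (by positivity) key 4
    rw [norm_inv, Real.norm_eq_abs, norm_pow, Real.norm_eq_abs]
    calc |x - c|⁻¹ ≤ ((1 - x^2) / 2)⁻¹ := inv_anti₀ (by positivity) (by linarith)
      _ = 2 * (1 - x^2)⁻¹ := by field_simp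
      _ ≤ 2 * ((1 - x^2)^4)⁻¹ := by
          gcongr
          exact pow_le_of_le_one hd.le hd1 (by norm_num)
      _ = 2 * (2 * c2 / a) ^ 4 * (a / 2 / (c2 * (1 - x^2))) ^ 4 := by field_simp
      _ ≤ 2 * (2 * c2 / a) ^ 4 * |u x / hs x| ^ 4 := by gcongr
      _ ≤ _ := by gcongr; linarith
  · simp only [G, if_neg hxI]
    nlinarith [norm_nonneg (x - c)⁻¹]

open Set Filter Topology in
lemma ddata (θ : ℝ → ℝ) (h : ContDiffOn ℝ 4 θ (Icc (-1 : ℝ) 1)) :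
    ∃ u f g : ℝ → ℝ, ContinuousOn u (Icc (-1) 1) ∧ ContinuousOn f (Icc (-1) 1) ∧
      ContinuousOn g (Icc (-1) 1) ∧
      (∀ x ∈ Ioo (-1:ℝ) 1, HasDerivAt u (f x) x) ∧ (∀ x ∈ Ioo (-1:ℝ) 1, HasDerivAt f (g x) x) ∧
      (∀ x ∈ Ioo (-1:ℝ) 1, deriv θ x = u x) ∧ (∀ x ∈ Ioo (-1:ℝ) 1, deriv (deriv θ) x = f x) ∧
      (∀ x ∈ Ioo (-1:ℝ) 1, deriv (deriv (deriv θ)) x = g x) := by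
  have hU : UniqueDiffOn ℝ (Icc (-1:ℝ) 1) := uniqueDiffOn_Icc (by norm_num)
  set I := Icc (-1:ℝ) 1 with hI
  have h1 : ContDiffOn ℝ 3 (derivWithin θ I) I := h.derivWithin hU (by norm_num)
  have h2 : ContDiffOn ℝ 2 (derivWithin (derivWithin θ I) I) I := h1.derivWithin hU (by norm_num)
  have h3 : ContDiffOn ℝ 1 (derivWithin (derivWithin (derivWithin θ I) I) I) I :=
    h2.derivWithin hU (by norm_num)
  have nh : ∀ x ∈ Ioo (-1:ℝ) 1, I ∈ 𝓝 x := fun x hx => Icc_mem_nhds hx.1 hx.2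
  have D : ∀ F : ℝ → ℝ, DifferentiableOn ℝ F I → ∀ x ∈ Ioo (-1:ℝ) 1,
      HasDerivAt F (derivWithin F I x) x := fun F hF x hx =>
    (hF x (Ioo_subset_Icc_self hx)).hasDerivWithinAt.hasDerivAt (nh x hx)
  have dθ := D θ (h.differentiableOn (by norm_num))
  have du := D _ (h1.differentiableOn (by norm_num))
  have df := D _ (h2.differentiableOn (by norm_num))
  have C : ∀ F G H : ℝ → ℝ, (∀ x ∈ Ioo (-1:ℝ) 1, F x = G x) →
      (∀ x ∈ Ioo (-1:ℝ) 1, HasDerivAt G (H x) x) → ∀ x ∈ Ioo (-1:ℝ) 1, deriv F x = H x := by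
    intro F G H e hG x hx
    have : F =ᶠ[𝓝 x] G := by
      filter_upwards [isOpen_Ioo.mem_nhds hx] with y hy using e y hy
    rw [this.deriv_eq, (hG x hx).deriv]
  have e1 := C θ θ _ (fun _ _ => rfl) dθ
  have e2 := C _ _ _ e1 du
  have e3 := C _ _ _ e2 df
  exact ⟨_, _, _, h1.continuousOn, h2.continuousOn, h3.continuousOn, du, df, e1, e2, e3⟩

open Set in
lemma icongr (F G : ℝ → ℝ) (h : ∀ x ∈ Ioo (-1:ℝ) 1, F x = G x) :
    ∫ x in (-1:ℝ)..1, F x = ∫ x in (-1:ℝ)..1, G x := by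
  rw [intervalIntegral.integral_of_le (by norm_num), intervalIntegral.integral_of_le (by norm_num),
    MeasureTheory.integral_Ioc_eq_integral_Ioo, MeasureTheory.integral_Ioc_eq_integral_Ioo]
  exact MeasureTheory.setIntegral_congr_fun measurableSet_Ioo h

lemma final_step (I P Q K : ℝ) (hI : 0 ≤ I) (hP : 0 ≤ P) (hQ : 0 ≤ Q) (hK : 0 ≤ K)
    (h : I ≤ K * (P + Q) ^ 2) :
    I ^ ((1 : ℝ) / 4) ≤ K ^ ((1 : ℝ) / 4) * (Real.sqrt Q + Real.sqrt P) := by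
  have sP := Real.sq_sqrt hP
  have sQ := Real.sq_sqrt hQ
  have p0 := Real.sqrt_nonneg P
  have q0 := Real.sqrt_nonneg Q
  have hB : P + Q ≤ (Real.sqrt Q + Real.sqrt P) ^ 2 := by nlinarith
  have h2 : I ≤ K * (Real.sqrt Q + Real.sqrt P) ^ 4 := by
    refine h.trans (mul_le_mul_of_nonneg_left ?_ hK)
    calc (P + Q)^2 ≤ ((Real.sqrt Q + Real.sqrt P) ^ 2)^2 := by gcongr
      _ = _ := by ring
  have h3 := Real.rpow_le_rpow hI h2 (by norm_num : (0:ℝ) ≤ 1/4)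
  rw [Real.mul_rpow hK (by positivity)] at h3
  have h4 : ((Real.sqrt Q + Real.sqrt P) ^ 4) ^ ((1:ℝ)/4) = Real.sqrt Q + Real.sqrt P := by
    rw [← Real.rpow_natCast, ← Real.rpow_mul (by positivity)]
    norm_num
  rwa [h4] at h3

theorem stmt_11 :
    ∃ C > (0 : ℝ), ∀ θ : ℝ → ℝ, ContDiffOn ℝ 4 θ (Set.Icc (-1 : ℝ) 1) →
      deriv θ (-1) = 0 → deriv θ 1 = 0 →
      (∫ ξ in (-1 : ℝ)..1, (deriv θ ξ / hs ξ) ^ 4) ^ ((1 : ℝ) / 4) +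
        (∫ ξ in (-1 : ℝ)..1, (deriv (deriv θ) ξ) ^ 4) ^ ((1 : ℝ) / 4) ≤
      C * (Real.sqrt (∫ ξ in (-1 : ℝ)..1,
              (hs ξ ^ ((3 : ℝ) / 2) * deriv (deriv (deriv (deriv θ))) ξ) ^ 2) +
           Real.sqrt (∫ ξ in (-1 : ℝ)..1,
              (hs ξ ^ ((1 : ℝ) / 2) * deriv (deriv (deriv θ)) ξ) ^ 2) +
           Real.sqrt (∫ ξ in (-1 : ℝ)..1, (deriv (deriv θ) ξ) ^ 2)) := by
  obtain ⟨c1, hc1, c2, hc2, hb⟩ := hs_bd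
  have hsc : Continuous hs := by unfold hs; fun_prop
  set L : ℝ := 1 + c1⁻¹ with hL
  have hLpos : 0 < L := by positivity
  have hL1 : 1 ≤ L := by have : 0 < c1⁻¹ := by positivity
                         linarith
  set K2 : ℝ := 12 * L ^ 2 with hK2
  set K1 : ℝ := c1⁻¹ ^ 4 * 432 * K2 with hK1
  have hK2p : 0 < K2 := by positivity
  have hK1p : 0 < K1 := by positivity
  refine ⟨K1 ^ ((1:ℝ)/4) + K2 ^ ((1:ℝ)/4), by positivity, fun θ hθ _ _ => ?_⟩
  obtain ⟨u, f, g, hu, hf, hg, du, df, e1, e2, e3⟩ := ddata θ hθ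
  have E1 : ∫ ξ in (-1 : ℝ)..1, (deriv θ ξ / hs ξ) ^ 4 = ∫ ξ in (-1 : ℝ)..1, (u ξ / hs ξ) ^ 4 :=
    icongr _ _ (fun x hx => by simp only [e1 x hx])
  have E2 : ∫ ξ in (-1 : ℝ)..1, (deriv (deriv θ) ξ) ^ 4 = ∫ ξ in (-1 : ℝ)..1, f ξ ^ 4 :=
    icongr _ _ (fun x hx => by simp only [e2 x hx])
  have E3 : ∫ ξ in (-1 : ℝ)..1, (hs ξ ^ ((1 : ℝ) / 2) * deriv (deriv (deriv θ)) ξ) ^ 2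
      = ∫ ξ in (-1 : ℝ)..1, hs ξ * g ξ ^ 2 := by
    refine icongr _ _ (fun x hx => ?_)
    have h0 : 0 ≤ hs x := by
      refine le_trans ?_ (hb x (Set.Ioo_subset_Icc_self hx)).1
      have : 0 ≤ 1 - x^2 := by nlinarith [hx.1, hx.2]
      positivity
    simp only [e3 x hx]
    rw [mul_pow, ← Real.sqrt_eq_rpow, Real.sq_sqrt h0]
  have E4 : ∫ ξ in (-1 : ℝ)..1, (deriv (deriv θ) ξ) ^ 2 = ∫ ξ in (-1 : ℝ)..1, f ξ ^ 2 :=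
    icongr _ _ (fun x hx => by simp only [e2 x hx])
  rw [E1, E2, E3, E4]
  have II : ∀ F : ℝ → ℝ, ContinuousOn F (Set.Icc (-1) 1) →
      IntervalIntegrable F MeasureTheory.volume (-1) 1 := by
    intro F hF
    apply ContinuousOn.intervalIntegrable
    rwa [Set.uIcc_of_le (by norm_num)]
  have hL4 := aux_L4 f g hf hg df
  have hQle : ∫ x in (-1:ℝ)..1, (1 - x^2) * g x ^ 2 ≤ c1⁻¹ * ∫ x in (-1:ℝ)..1, hs x * g x ^ 2 := by
    rw [← intervalIntegral.integral_const_mul]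
    apply intervalIntegral.integral_mono_on (by norm_num) (II _ (by fun_prop)) (II _ (by fun_prop))
    intro x hx
    have := mul_le_mul_of_nonneg_right (hb x hx).1 (sq_nonneg (g x))
    rw [← mul_assoc]
    calc (1 - x^2) * g x^2 = c1⁻¹ * (c1 * (1 - x^2) * g x ^ 2) := by field_simp
      _ ≤ c1⁻¹ * (hs x * g x ^ 2) := by gcongr
      _ = _ := by ring
  have hQ0' : 0 ≤ ∫ x in (-1:ℝ)..1, (1 - x^2) * g x ^ 2 :=
    intervalIntegral.integral_nonneg (by norm_num) (fun x hx => by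
      have : 0 ≤ 1 - x^2 := by nlinarith [hx.1, hx.2]
      positivity)
  have hP0 : 0 ≤ ∫ x in (-1:ℝ)..1, f x ^ 2 :=
    intervalIntegral.integral_nonneg (by norm_num) (fun x _ => sq_nonneg _)
  have hQ0 : 0 ≤ ∫ x in (-1:ℝ)..1, hs x * g x ^ 2 :=
    intervalIntegral.integral_nonneg (by norm_num) (fun x hx => by
      have : 0 ≤ 1 - x^2 := by nlinarith [hx.1, hx.2]
      have : 0 ≤ hs x := le_trans (by positivity) (hb x hx).1
      positivity)
  have hI20 : 0 ≤ ∫ x in (-1:ℝ)..1, f x ^ 4 :=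
    intervalIntegral.integral_nonneg (by norm_num) (fun x _ => by positivity)
  have hI10 : 0 ≤ ∫ x in (-1:ℝ)..1, (u x / hs x) ^ 4 :=
    intervalIntegral.integral_nonneg (by norm_num) (fun x _ => by positivity)
  have hI1 : ∫ x in (-1:ℝ)..1, (u x / hs x) ^ 4 ≤ c1⁻¹ ^ 4 * 432 * ∫ x in (-1:ℝ)..1, f x ^ 4 := by
    by_cases hint : IntervalIntegrable (fun x => (u x / hs x) ^ 4) MeasureTheory.volume (-1) 1
    · have hu1 := endpoint u hu 1 (Or.inl rfl) hint
      have hu2 := endpoint u hu (-1) (Or.inr rfl) hint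
      obtain ⟨hi, hh⟩ := aux_hardy u f hu hf du hu2 hu1
      have : ∫ x in (-1:ℝ)..1, (u x / hs x) ^ 4 ≤
          ∫ x in (-1:ℝ)..1, c1⁻¹ ^ 4 * (u x / (1 - x^2)) ^ 4 := by
        apply intervalIntegral.integral_mono_on_of_le_Ioo (by norm_num) hint (hi.const_mul _)
        intro x hx
        have hd : 0 < 1 - x^2 := by nlinarith [hx.1, hx.2]
        have b1 := (hb x (Set.Ioo_subset_Icc_self hx)).1
        have hcd : 0 < c1 * (1 - x^2) := by positivity
        have hsp : 0 < hs x := hcd.trans_le b1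
        rw [← mul_pow, ← (show Even 4 by decide).pow_abs, ← (show Even 4 by decide).pow_abs (c1⁻¹ * _)]
        refine pow_le_pow_left₀ (abs_nonneg _) ?_ 4
        rw [abs_mul, abs_div, abs_div, abs_of_pos hsp, abs_of_pos hd, abs_of_pos (inv_pos.2 hc1)]
        calc |u x| / hs x ≤ |u x| / (c1 * (1 - x^2)) := by gcongr
          _ = _ := by field_simp
      rw [intervalIntegral.integral_const_mul] at this
      refine this.trans ?_
      rw [mul_assoc]
      gcongr
    · rw [intervalIntegral.integral_undef hint]
      positivity
  set P := ∫ x in (-1:ℝ)..1, f x ^ 2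
  set Q' := ∫ x in (-1:ℝ)..1, (1 - x^2) * g x ^ 2
  set Q := ∫ x in (-1:ℝ)..1, hs x * g x ^ 2
  set I2 := ∫ x in (-1:ℝ)..1, f x ^ 4
  set I1 := ∫ x in (-1:ℝ)..1, (u x / hs x) ^ 4
  have hI2' : I2 ≤ K2 * (P + Q) ^ 2 := by
    have h1 : P + Q' ≤ L * (P + Q) := by
      have : 0 ≤ c1⁻¹ * P := by positivity
      rw [hL]; nlinarith
    calc I2 ≤ 12 * (P + Q') ^ 2 := hL4
      _ ≤ 12 * (L * (P + Q)) ^ 2 := by gcongr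
      _ = _ := by rw [hK2]; ring
  have hI1' : I1 ≤ K1 * (P + Q) ^ 2 := by
    calc I1 ≤ c1⁻¹ ^ 4 * 432 * I2 := hI1
      _ ≤ c1⁻¹ ^ 4 * 432 * (K2 * (P + Q) ^ 2) := by gcongr
      _ = _ := by rw [hK1]; ring
  have r1 := final_step I1 P Q K1 hI10 hP0 hQ0 hK1p.le hI1'
  have r2 := final_step I2 P Q K2 hI20 hP0 hQ0 hK2p.le hI2'
  refine (add_le_add r1 r2).trans ?_
  rw [← add_mul]
  refine mul_le_mul_of_nonneg_left ?_ (by positivity)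
  have := Real.sqrt_nonneg (∫ ξ in (-1 : ℝ)..1,
              (hs ξ ^ ((3 : ℝ) / 2) * deriv (deriv (deriv (deriv θ))) ξ) ^ 2)
  linarith
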